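/- For i = 1, 2 the following Pohozaev identity holds: (1/2) ∫_{∂B₁} |∂v/∂ν|² x_i dσ − 2Nλ ∫_{B₁} y_i |y|^{2N} V(y) e^{v(y)} dy + λ ∫_{∂B₁} x_i V(x) dσ = 4Nπ (∂v/∂x_i)(0) + λ ∫_{B₁} |x|^{2N} (∂V/∂x_i)(x) e^{v(x)} dx. -/

import Mathlib

open MeasureTheory Filter Metric Set

noncomputable section

/-- Directional derivative of a function `f : ℂ → ℝ` in direction `v`. -/
def dderiv (v : ℂ) (f : ℂ → ℝ) : ℂ → ℝ := fun z => fderiv ℝ f z v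

/-- Iterated partial derivative `∂ₓ^m ∂_y^n f` of `f : ℂ → ℝ`. -/
def pd (m n : ℕ) (f : ℂ → ℝ) : ℂ → ℝ := (dderiv 1)^[m] ((dderiv Complex.I)^[n] f)

/-- Laplacian of `f : ℂ → ℝ`. -/
def lap (f : ℂ → ℝ) : ℂ → ℝ := fun z => pd 2 0 f z + pd 0 2 f z

/-- Gradient of `f : ℂ → ℝ` at `z`, viewed as a complex number. -/
def grad (f : ℂ → ℝ) (z : ℂ) : ℂ :=
  (dderiv 1 f z : ℂ) + (dderiv Complex.I f z : ℂ) * Complex.I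

open scoped Topology

theorem clm_apply_eq (L : ℂ →L[ℝ] ℝ) (w : ℂ) : L w = w.re * L 1 + w.im * L Complex.I := by
  conv_lhs => rw [← Complex.re_add_im w]
  have h1 : (w.re : ℂ) = w.re • (1 : ℂ) := by simp
  have h2 : (w.im : ℂ) * Complex.I = w.im • Complex.I := by simp
  rw [map_add, h2, h1, map_smul, map_smul]
  simp

theorem polar_mem {ε r : ℝ} (hε : 0 ≤ ε) (θ : ℝ) (hr : r ∈ Icc ε 1) :
    (r : ℂ) * Complex.exp (θ * Complex.I) ∈ closedBall (0 : ℂ) 1 \ ball 0 ε := by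
  have : |r| = r := abs_of_nonneg (hε.trans hr.1)
  simp [Complex.norm_exp_ofReal_mul_I, this, hr.1, hr.2]

/-- The divergence theorem for the vector field `(P, Q)` on an annulus, in polar coordinates. -/
theorem integral_divergence_annulus {ε : ℝ} (hε : 0 ≤ ε) (hε1 : ε ≤ 1) {P Q D : ℂ → ℝ}
    (hP : ContinuousOn P (closedBall 0 1 \ ball 0 ε))
    (hQ : ContinuousOn Q (closedBall 0 1 \ ball 0 ε))
    (hD : ContinuousOn D (closedBall 0 1 \ ball 0 ε))
    (hdiv : ∀ z : ℂ, ε < ‖z‖ → ‖z‖ < 1 → ∃ A B : ℂ →L[ℝ] ℝ,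
      HasFDerivAt P A z ∧ HasFDerivAt Q B z ∧ A 1 + B Complex.I = D z) :
    ∫ r in ε..1, ∫ θ in (0 : ℝ)..(2 * Real.pi), r * D (r * Complex.exp (θ * Complex.I)) =
      (∫ θ in (0 : ℝ)..(2 * Real.pi), (P (Complex.exp (θ * Complex.I)) * Real.cos θ +
        Q (Complex.exp (θ * Complex.I)) * Real.sin θ)) -
      ∫ θ in (0 : ℝ)..(2 * Real.pi), ε * (P (ε * Complex.exp (θ * Complex.I)) * Real.cos θ +
        Q (ε * Complex.exp (θ * Complex.I)) * Real.sin θ) := by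
  have hdiv' : ∀ z : ℂ, ∃ A B : ℂ →L[ℝ] ℝ, A 1 + B Complex.I = D z ∧
      (ε < ‖z‖ → ‖z‖ < 1 → HasFDerivAt P A z ∧ HasFDerivAt Q B z) := by
    intro z
    by_cases h : ε < ‖z‖ ∧ ‖z‖ < 1
    · obtain ⟨A, B, hA, hB, hAB⟩ := hdiv z h.1 h.2
      exact ⟨A, B, hAB, fun _ _ => ⟨hA, hB⟩⟩
    · exact ⟨D z • Complex.reCLM, 0, by simp, fun h1 h2 => absurd ⟨h1, h2⟩ h⟩
  choose A B hAB hder using hdiv'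
  set Φ : ℝ × ℝ → ℂ := fun p => p.1 * Complex.exp (p.2 * Complex.I) with hΦ
  set Φ' : ℝ × ℝ → ℝ × ℝ →L[ℝ] ℂ := fun p =>
    (ContinuousLinearMap.fst ℝ ℝ ℝ).smulRight (Complex.exp (p.2 * Complex.I)) +
    (ContinuousLinearMap.snd ℝ ℝ ℝ).smulRight
      (p.1 * (Complex.I * Complex.exp (p.2 * Complex.I))) with hΦ'
  have hΦc : Continuous Φ := by fun_prop
  have hΦd : ∀ p, HasFDerivAt Φ (Φ' p) p := by
    intro p
    have h1 : HasFDerivAt (fun p : ℝ × ℝ => (p.1 : ℂ))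
        (Complex.ofRealCLM.comp (ContinuousLinearMap.fst ℝ ℝ ℝ)) p :=
      (Complex.ofRealCLM.comp (ContinuousLinearMap.fst ℝ ℝ ℝ)).hasFDerivAt
    have h2 : HasFDerivAt (fun p : ℝ × ℝ => (p.2 : ℂ))
        (Complex.ofRealCLM.comp (ContinuousLinearMap.snd ℝ ℝ ℝ)) p :=
      (Complex.ofRealCLM.comp (ContinuousLinearMap.snd ℝ ℝ ℝ)).hasFDerivAt
    have h3 := h1.mul (h2.mul_const Complex.I).cexp
    convert! h3 using 1
    ext <;> simp [hΦ', mul_comm, mul_left_comm]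
  set R : Set (ℝ × ℝ) := uIcc ε 1 ×ˢ uIcc 0 (2 * Real.pi) with hR
  have hmaps : MapsTo Φ R (closedBall 0 1 \ ball 0 ε) := by
    rintro ⟨r, θ⟩ ⟨hr, -⟩
    rw [uIcc_of_le hε1] at hr
    exact polar_mem hε θ hr
  have hcP : ContinuousOn (fun p => P (Φ p)) R := hP.comp hΦc.continuousOn hmaps
  have hcQ : ContinuousOn (fun p => Q (Φ p)) R := hQ.comp hΦc.continuousOn hmaps
  have hcD : ContinuousOn (fun p => D (Φ p)) R := hD.comp hΦc.continuousOn hmaps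
  have hcos : ∀ p : ℝ × ℝ, HasFDerivAt (fun p : ℝ × ℝ => Real.cos p.2)
      (-Real.sin p.2 • ContinuousLinearMap.snd ℝ ℝ ℝ) p := fun p =>
    (ContinuousLinearMap.snd ℝ ℝ ℝ).hasFDerivAt.cos
  have hsin : ∀ p : ℝ × ℝ, HasFDerivAt (fun p : ℝ × ℝ => Real.sin p.2)
      (Real.cos p.2 • ContinuousLinearMap.snd ℝ ℝ ℝ) p := fun p =>
    (ContinuousLinearMap.snd ℝ ℝ ℝ).hasFDerivAt.sin
  have hfst : ∀ p : ℝ × ℝ, HasFDerivAt (fun p : ℝ × ℝ => p.1)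
      (ContinuousLinearMap.fst ℝ ℝ ℝ) p := fun p =>
    (ContinuousLinearMap.fst ℝ ℝ ℝ).hasFDerivAt
  have hin : ∀ p ∈ Ioo (min ε 1) (max ε 1) ×ˢ Ioo (min 0 (2 * Real.pi)) (max 0 (2 * Real.pi))
      \ (∅ : Set (ℝ × ℝ)), HasFDerivAt (fun p => P (Φ p)) ((A (Φ p)).comp (Φ' p)) p ∧
        HasFDerivAt (fun p => Q (Φ p)) ((B (Φ p)).comp (Φ' p)) p := by
    rintro p ⟨⟨hp, -⟩, -⟩
    rw [min_eq_left hε1, max_eq_right hε1] at hp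
    have hn : ‖Φ p‖ = p.1 := by
      simp [hΦ, Complex.norm_exp_ofReal_mul_I, abs_of_nonneg (hε.trans hp.1.le)]
    obtain ⟨h1, h2⟩ := hder (Φ p) (by rw [hn]; exact hp.1) (by rw [hn]; exact hp.2)
    exact ⟨h1.comp p (hΦd p), h2.comp p (hΦd p)⟩
  have hcosc : ContinuousOn (fun p : ℝ × ℝ => Real.cos p.2) R := by fun_prop
  have hsinc : ContinuousOn (fun p : ℝ × ℝ => Real.sin p.2) R := by fun_prop
  have key := integral2_divergence_prod_of_hasFDerivAt_off_countable
    (fun p => p.1 * (P (Φ p) * Real.cos p.2 + Q (Φ p) * Real.sin p.2))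
    (fun p => Q (Φ p) * Real.cos p.2 - P (Φ p) * Real.sin p.2) _ _ ε 0 1 (2 * Real.pi) ∅
    countable_empty
    (continuousOn_fst.mul ((hcP.mul hcosc).add (hcQ.mul hsinc)))
    ((hcQ.mul hcosc).sub (hcP.mul hsinc))
    (fun p hp => (hfst p).mul (((hin p hp).1.mul (hcos p)).add ((hin p hp).2.mul (hsin p))))
    (fun p hp => (((hin p hp).2.mul (hcos p)).sub ((hin p hp).1.mul (hsin p))))
  have hpt : ∀ p : ℝ × ℝ,
      ((p.1 • (P (Φ p) • (-Real.sin p.2 • (ContinuousLinearMap.snd ℝ ℝ ℝ)) +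
        Real.cos p.2 • (A (Φ p)).comp (Φ' p) +
        (Q (Φ p) • (Real.cos p.2 • (ContinuousLinearMap.snd ℝ ℝ ℝ)) +
        Real.sin p.2 • (B (Φ p)).comp (Φ' p))) +
        (P (Φ p) * Real.cos p.2 + Q (Φ p) * Real.sin p.2) • ContinuousLinearMap.fst ℝ ℝ ℝ) (1, 0)
      + ((Q (Φ p) • (-Real.sin p.2 • (ContinuousLinearMap.snd ℝ ℝ ℝ)) +
        Real.cos p.2 • (B (Φ p)).comp (Φ' p) -
        (P (Φ p) • (Real.cos p.2 • (ContinuousLinearMap.snd ℝ ℝ ℝ)) +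
        Real.sin p.2 • (A (Φ p)).comp (Φ' p)))) (0, 1)) = p.1 * D (Φ p) := by
    intro p
    rw [← hAB]
    simp only [hΦ', _root_.add_apply, _root_.sub_apply,
      _root_.smul_apply, ContinuousLinearMap.comp_apply,
      ContinuousLinearMap.smulRight_apply, ContinuousLinearMap.coe_fst',
      ContinuousLinearMap.coe_snd', smul_eq_mul, one_smul, zero_smul, add_zero, zero_add]
    rw [clm_apply_eq (A (Φ p)) (Complex.exp _), clm_apply_eq (B (Φ p)) (Complex.exp _),
      clm_apply_eq (A (Φ p)) (_ * _), clm_apply_eq (B (Φ p)) (_ * _)]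
    simp [Complex.exp_ofReal_mul_I_re, Complex.exp_ofReal_mul_I_im]
    linear_combination (p.1 * (A (Φ p) 1) + p.1 * B (Φ p) Complex.I) * Real.sin_sq_add_cos_sq p.2
  have hpt' := fun x y : ℝ => hpt (x, y)
  simp only at hpt'
  simp only [hpt, hpt'] at key
  have key2 := key ((continuousOn_fst.mul hcD).integrableOn_compact
    (isCompact_uIcc.prod isCompact_uIcc))
  simp only [hΦ] at key2
  rw [key2]
  have hper : Complex.exp (((2 * Real.pi : ℝ) : ℂ) * Complex.I) = 1 := by
    push_cast; exact Complex.exp_two_pi_mul_I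
  simp only [hper]
  simp

theorem integral_ball_eq_polar {D : ℂ → ℝ} (hD : ContinuousOn D (closedBall 0 1)) :
    ∫ z in ball (0 : ℂ) 1, D z =
      ∫ r in (0 : ℝ)..1, ∫ θ in (0 : ℝ)..(2 * Real.pi), r * D (r * Complex.exp (θ * Complex.I)) := by
  rw [← integral_indicator measurableSet_ball, ← Complex.integral_comp_polarCoord_symm]
  have hcont : Continuous (fun p : ℝ × ℝ => (p.1 : ℂ) * Complex.exp (p.2 * Complex.I)) := by
    fun_prop
  have h1 : ∫ p in polarCoord.target, p.1 • (ball (0 : ℂ) 1).indicator D (Complex.polarCoord.symm p)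
      = ∫ p in Ioo (0 : ℝ) 1 ×ˢ Ioo (-Real.pi) Real.pi,
        p.1 * D (p.1 * Complex.exp (p.2 * Complex.I)) := by
    rw [← integral_indicator polarCoord.open_target.measurableSet,
      ← integral_indicator (measurableSet_Ioo.prod measurableSet_Ioo)]
    congr 1
    ext p
    have e : Complex.polarCoord.symm p = p.1 * Complex.exp (p.2 * Complex.I) := by
      rw [Complex.polarCoord_symm_apply, Complex.exp_mul_I]; push_cast; rfl
    have hn : ‖(p.1 : ℂ) * Complex.exp (p.2 * Complex.I)‖ = |p.1| := by
      simp [Complex.norm_exp_ofReal_mul_I]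
    have hind : (ball (0 : ℂ) 1).indicator D (p.1 * Complex.exp (p.2 * Complex.I)) =
        if |p.1| < 1 then D (p.1 * Complex.exp (p.2 * Complex.I)) else 0 := by
      classical
      rw [indicator_apply, mem_ball_zero_iff, hn]
    simp only [e, hind, indicator_apply, polarCoord_target, mem_prod, mem_Ioi, mem_Ioo]
    by_cases h0 : 0 < p.1
    · rw [abs_of_pos h0]
      by_cases h2 : p.1 < 1 <;> simp [h0, h2]
    · simp [h0]
  rw [h1]
  have hint : IntegrableOn (fun p : ℝ × ℝ => p.1 * D (p.1 * Complex.exp (p.2 * Complex.I)))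
      (Ioo (0 : ℝ) 1 ×ˢ Ioo (-Real.pi) Real.pi) := by
    refine IntegrableOn.mono_set (t := Icc (0 : ℝ) 1 ×ˢ Icc (-Real.pi) Real.pi) ?_
      (prod_mono Ioo_subset_Icc_self Ioo_subset_Icc_self)
    refine ContinuousOn.integrableOn_compact (isCompact_Icc.prod isCompact_Icc) ?_
    refine continuousOn_fst.mul (hD.comp hcont.continuousOn ?_)
    rintro ⟨r, θ⟩ ⟨hr, -⟩
    exact (polar_mem le_rfl θ hr).1
  rw [Measure.volume_eq_prod] at hint ⊢
  rw [setIntegral_prod _ hint, intervalIntegral.integral_of_le zero_le_one,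
    integral_Ioc_eq_integral_Ioo]
  congr 1
  ext r
  have hper : Function.Periodic (fun θ : ℝ => r * D (r * Complex.exp (θ * Complex.I)))
      (2 * Real.pi) := by
    intro θ
    simp only []
    push_cast
    rw [add_mul, Complex.exp_periodic]
  have := hper.intervalIntegral_add_eq (-Real.pi) 0
  rw [zero_add, show -Real.pi + 2 * Real.pi = Real.pi by ring] at this
  rw [← this, intervalIntegral.integral_of_le (by linarith [Real.pi_pos]),
    integral_Ioc_eq_integral_Ioo]

theorem tendsto_integral_annulus {D : ℂ → ℝ} (hD : ContinuousOn D (closedBall 0 1)) :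
    Tendsto (fun ε : ℝ => ∫ r in ε..1, ∫ θ in (0 : ℝ)..(2 * Real.pi),
      r * D (r * Complex.exp (θ * Complex.I))) (𝓝[>] 0) (𝓝 (∫ z in ball (0 : ℂ) 1, D z)) := by
  rw [integral_ball_eq_polar hD]
  have hcont : Continuous (fun p : ℝ × ℝ => (p.1 : ℂ) * Complex.exp (p.2 * Complex.I)) := by
    fun_prop
  have hint : IntegrableOn (fun p : ℝ × ℝ => p.1 * D (p.1 * Complex.exp (p.2 * Complex.I)))
      (Icc (0 : ℝ) 1 ×ˢ Icc 0 (2 * Real.pi)) := by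
    refine ContinuousOn.integrableOn_compact (isCompact_Icc.prod isCompact_Icc) ?_
    refine continuousOn_fst.mul (hD.comp hcont.continuousOn ?_)
    rintro ⟨r, θ⟩ ⟨hr, -⟩
    exact (polar_mem le_rfl θ hr).1
  rw [IntegrableOn, Measure.volume_eq_prod, ← Measure.prod_restrict] at hint
  have h2 := hint.integral_prod_left
  have h3 : IntegrableOn (fun r : ℝ => ∫ θ in (0 : ℝ)..(2 * Real.pi),
      r * D (r * Complex.exp (θ * Complex.I))) (uIcc 0 1) := by
    rw [uIcc_of_le zero_le_one]
    refine h2.congr (Eventually.of_forall fun r => ?_)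
    simp only []
    rw [intervalIntegral.integral_of_le Real.two_pi_pos.le, ← integral_Icc_eq_integral_Ioc]
  have h4 := (intervalIntegral.continuousOn_primitive_interval_left h3) 0 left_mem_uIcc
  rw [uIcc_of_le zero_le_one] at h4
  exact h4.mono_left (nhdsWithin_le_of_mem (mem_of_superset (Ioo_mem_nhdsGT zero_lt_one)
    Ioo_subset_Icc_self))

section Gradient

variable {v : ℂ → ℝ}

theorem hasFDerivAt_of_contDiffOn_closedBall (hv : ContDiffOn ℝ 1 v (closedBall (0 : ℂ) 1))
    {z : ℂ} (hz : z ∈ ball (0 : ℂ) 1) :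
    HasFDerivAt v (fderivWithin ℝ v (closedBall 0 1) z) z :=
  ((hv.differentiableOn one_ne_zero z (ball_subset_closedBall hz)).hasFDerivWithinAt).hasFDerivAt
    (mem_of_superset (isOpen_ball.mem_nhds hz) ball_subset_closedBall)

theorem continuousOn_fderivWithin_closedBall (hv : ContDiffOn ℝ 1 v (closedBall (0 : ℂ) 1)) :
    ContinuousOn (fderivWithin ℝ v (closedBall 0 1)) (closedBall 0 1) :=
  hv.continuousOn_fderivWithin
    (uniqueDiffOn_convex (convex_closedBall _ _) (by simp [interior_closedBall])) le_rfl

theorem exists_hasFDerivAt_partial (hv1 : ContDiffOn ℝ 1 v (closedBall (0 : ℂ) 1))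
    (hv2 : ContDiffOn ℝ 2 v (ball (0 : ℂ) 1)) {z : ℂ} (hz : z ∈ ball (0 : ℂ) 1) :
    ∃ X Y : ℂ →L[ℝ] ℝ,
      HasFDerivAt (fun w => fderivWithin ℝ v (closedBall 0 1) w 1) X z ∧
      HasFDerivAt (fun w => fderivWithin ℝ v (closedBall 0 1) w Complex.I) Y z ∧
      X Complex.I = Y 1 ∧ X 1 + Y Complex.I = lap v z := by
  have hnhds := isOpen_ball.mem_nhds hz
  have hat : ContDiffAt ℝ 2 v z := hv2.contDiffAt hnhds
  have hsymm : IsSymmSndFDerivAt ℝ v z := hat.isSymmSndFDerivAt (by simp)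
  have hd : DifferentiableAt ℝ (fderiv ℝ v) z :=
    (hat.fderiv_right (m := 1) (by norm_num)).differentiableAt one_ne_zero
  have hder : ∀ e : ℂ, HasFDerivAt (fun w => fderiv ℝ v w e)
      ((fderiv ℝ (fderiv ℝ v) z).flip e) z := by
    intro e
    have := hd.hasFDerivAt.clm_apply (hasFDerivAt_const e z)
    simpa using this
  have heq : ∀ e : ℂ, (fun w => fderivWithin ℝ v (closedBall 0 1) w e) =ᶠ[𝓝 z]
      fun w => fderiv ℝ v w e := by
    intro e
    filter_upwards [hnhds] with w hw
    rw [(hasFDerivAt_of_contDiffOn_closedBall hv1 hw).fderiv]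
  refine ⟨_, _, (hder 1).congr_of_eventuallyEq (heq 1),
    (hder Complex.I).congr_of_eventuallyEq (heq Complex.I), ?_, ?_⟩
  · exact hsymm _ _
  · have h1 := congrArg (fun L : ℂ →L[ℝ] ℝ => L 1) (hder 1).fderiv
    have h2 := congrArg (fun L : ℂ →L[ℝ] ℝ => L Complex.I) (hder Complex.I).fderiv
    exact (congrArg₂ (· + ·) h1 h2).symm

theorem fderivWithin_tangent_eq_zero (hv : ContDiffOn ℝ 1 v (closedBall (0 : ℂ) 1))
    (hbd : ∀ x ∈ sphere (0 : ℂ) 1, v x = 0) (θ : ℝ) :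
    fderivWithin ℝ v (closedBall 0 1) (Complex.exp (θ * Complex.I))
      (Complex.exp (θ * Complex.I) * Complex.I) = 0 := by
  have hn : ∀ t : ℝ, ‖Complex.exp (t * Complex.I)‖ = 1 := Complex.norm_exp_ofReal_mul_I
  have h1 : HasDerivAt (fun t : ℝ => Complex.exp (t * Complex.I))
      (Complex.exp (θ * Complex.I) * Complex.I) θ := by
    simpa using ((Complex.ofRealCLM.hasDerivAt (x := θ)).mul_const Complex.I).cexp
  have h2 := ((hv.differentiableOn one_ne_zero _
    (by simp [hn] : Complex.exp (θ * Complex.I) ∈ closedBall (0 : ℂ) 1)).hasFDerivWithinAt).comp_hasDerivAt θ h1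
    (Eventually.of_forall fun t => by simp [hn])
  have h3 : v ∘ (fun t : ℝ => Complex.exp (t * Complex.I)) = fun _ => 0 := by
    ext t
    exact hbd _ (by simp [hn])
  rw [h3] at h2
  exact h2.unique (hasDerivAt_const θ (0 : ℝ))

end Gradient

theorem norm_sq_eq (z : ℂ) : ‖z‖ ^ 2 = z.re ^ 2 + z.im ^ 2 := by
  rw [Complex.sq_norm, Complex.normSq_apply]; ring

theorem hasFDerivAt_norm_sq (z : ℂ) : HasFDerivAt (fun w : ℂ => ‖w‖ ^ 2)
    ((2 * z.re) • Complex.reCLM + (2 * z.im) • Complex.imCLM) z := by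
  have h : (fun w : ℂ => ‖w‖ ^ 2) = fun w => w.re ^ 2 + w.im ^ 2 :=
    funext norm_sq_eq
  rw [h]
  have := ((Complex.reCLM.hasFDerivAt (x := z)).pow 2).fun_add
    ((Complex.imCLM.hasFDerivAt (x := z)).pow 2)
  simpa using! this

section Pohozaev

variable {V v : ℂ → ℝ}

/-- The Pohozaev identity for the translation field in direction `(a, b)`. -/
theorem integral_translation_divergence {M : ℕ} {lam : ℝ}
    (hV : ContDiffOn ℝ 1 V (closedBall (0 : ℂ) 1))
    (hv1 : ContDiffOn ℝ 1 v (closedBall (0 : ℂ) 1))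
    (hv2 : ContDiffOn ℝ 2 v (ball (0 : ℂ) 1))
    (hPDE : ∀ x ∈ ball (0 : ℂ) 1,
      -lap v x = lam * ‖x‖ ^ (2 * (M + 1)) * V x * Real.exp (v x))
    (hbd : ∀ x ∈ sphere (0 : ℂ) 1, v x = 0) (a b : ℝ) :
    ∫ z in ball (0 : ℂ) 1, lam * (2 * (M + 1) * (a * z.re + b * z.im) * ‖z‖ ^ (2 * M) * V z +
        ‖z‖ ^ (2 * (M + 1)) * (a * fderivWithin ℝ V (closedBall 0 1) z 1 +
          b * fderivWithin ℝ V (closedBall 0 1) z Complex.I)) * Real.exp (v z) =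
      ∫ θ in (0 : ℝ)..(2 * Real.pi), (1 / 2 * ((fderivWithin ℝ v (closedBall (0 : ℂ) 1)
        (Complex.exp (θ * Complex.I)) (Complex.exp (θ * Complex.I))) ^ 2 *
        (a * Real.cos θ + b * Real.sin θ)) +
        lam * ((a * Real.cos θ + b * Real.sin θ) * V (Complex.exp (θ * Complex.I)))) := by
  set K := closedBall (0 : ℂ) 1 with hK
  set g := fderivWithin ℝ v K with hg
  set G := fderivWithin ℝ V K with hG
  have hgc : ContinuousOn g K := continuousOn_fderivWithin_closedBall hv1
  have hGc : ContinuousOn G K := continuousOn_fderivWithin_closedBall hV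
  have hgc1 : ∀ e, ContinuousOn (fun z => g z e) K := fun e => hgc.clm_apply continuousOn_const
  have hGc1 : ∀ e, ContinuousOn (fun z => G z e) K := fun e => hGc.clm_apply continuousOn_const
  have hgx := hgc1 1
  have hgy := hgc1 Complex.I
  have hGx := hGc1 1
  have hGy := hGc1 Complex.I
  have hvc := hv1.continuousOn
  have hVc := hV.continuousOn
  have hDc : ContinuousOn (fun z : ℂ => lam * (2 * (M + 1) * (a * z.re + b * z.im) *
      ‖z‖ ^ (2 * M) * V z + ‖z‖ ^ (2 * (M + 1)) * (a * G z 1 + b * G z Complex.I)) *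
      Real.exp (v z)) K := by fun_prop
  have key := integral_divergence_annulus le_rfl zero_le_one
    (P := fun z => g z 1 * (a * g z 1 + b * g z Complex.I) -
      a * (1 / 2 * (g z 1 ^ 2 + g z Complex.I ^ 2)) +
      a * (lam * ((‖z‖ ^ 2) ^ (M + 1) * V z * Real.exp (v z))))
    (Q := fun z => g z Complex.I * (a * g z 1 + b * g z Complex.I) -
      b * (1 / 2 * (g z 1 ^ 2 + g z Complex.I ^ 2)) +
      b * (lam * ((‖z‖ ^ 2) ^ (M + 1) * V z * Real.exp (v z))))
    (D := fun z => lam * (2 * (M + 1) * (a * z.re + b * z.im) *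
      ‖z‖ ^ (2 * M) * V z + ‖z‖ ^ (2 * (M + 1)) * (a * G z 1 + b * G z Complex.I)) *
      Real.exp (v z))
    (by rw [ball_zero, sdiff_empty]; fun_prop) (by rw [ball_zero, sdiff_empty]; fun_prop)
    (by rw [ball_zero, sdiff_empty]; exact hDc) ?_
  · rw [integral_ball_eq_polar hDc, key]
    simp only [zero_mul, intervalIntegral.integral_zero, sub_zero]
    refine intervalIntegral.integral_congr fun θ _ => ?_
    have ht := fderivWithin_tangent_eq_zero hv1 hbd θ
    have hr := clm_apply_eq (g (Complex.exp (θ * Complex.I))) (Complex.exp (θ * Complex.I))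
    rw [clm_apply_eq] at ht
    rw [← hK, ← hg] at ht
    have hn : ‖Complex.exp (θ * Complex.I)‖ = 1 := Complex.norm_exp_ofReal_mul_I θ
    have hv0 : v (Complex.exp (θ * Complex.I)) = 0 := hbd _ (by simp [hn])
    simp only [Complex.mul_re, Complex.mul_im, Complex.I_re, Complex.I_im,
      Complex.exp_ofReal_mul_I_re, Complex.exp_ofReal_mul_I_im] at ht hr
    simp only [hr, hn, hv0, Real.exp_zero, one_pow, one_mul, mul_one]
    have hcs := Real.sin_sq_add_cos_sq θ
    generalize Real.cos θ = c at *
    generalize Real.sin θ = s at *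
    generalize g (Complex.exp (θ * Complex.I)) 1 = p at *
    generalize g (Complex.exp (θ * Complex.I)) Complex.I = q at *
    have hp : p = c * (c * p + s * q) := by linear_combination (-p) * hcs - s * ht
    have hq : q = s * (c * p + s * q) := by linear_combination (-q) * hcs + c * ht
    generalize c * p + s * q = R at *
    subst hp hq
    linear_combination (R ^ 2 * (a * c + b * s) / 2) * hcs
  · intro z hz0 hz1
    have hzb : z ∈ ball (0 : ℂ) 1 := by simpa using hz1
    obtain ⟨X, Y, hX, hY, hXY, hlap⟩ := exists_hasFDerivAt_partial hv1 hv2 hzb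
    have hdv : HasFDerivAt v (g z) z := hasFDerivAt_of_contDiffOn_closedBall hv1 hzb
    have hdV : HasFDerivAt V (G z) z := hasFDerivAt_of_contDiffOn_closedBall hV hzb
    have hW := ((((hasFDerivAt_norm_sq z).pow (M + 1)).fun_mul hdV).fun_mul hdv.exp).const_mul lam
    have hE := ((hX.pow 2).fun_add (hY.pow 2)).const_mul (1 / 2 : ℝ)
    have hL := (hX.const_mul a).fun_add (hY.const_mul b)
    refine ⟨_, _, ((hX.fun_mul hL).fun_sub (hE.const_mul a)).fun_add (hW.const_mul a),
      ((hY.fun_mul hL).fun_sub (hE.const_mul b)).fun_add (hW.const_mul b), ?_⟩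
    have hpde := hPDE z hzb
    rw [← hlap, pow_mul, pow_succ] at hpde
    rw [← hK, ← hg]
    simp only [_root_.add_apply, _root_.sub_apply, _root_.smul_apply, smul_eq_mul,
      Complex.reCLM_apply, Complex.imCLM_apply, Complex.one_re, Complex.one_im, Complex.I_re,
      Complex.I_im, pow_mul, Nat.add_sub_cancel, pow_succ, nsmul_eq_mul, Nat.cast_add,
      Nat.cast_one, pow_zero, one_mul]
    rw [← pow_two, norm_sq_eq] at *
    generalize (z.re ^ 2 + z.im ^ 2) ^ M = m at *
    push_cast
    linear_combination (a * g z Complex.I - b * g z 1) * hXY -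
      (a * g z 1 + b * g z Complex.I) * hpde

/-- Green's identity on an annulus for `v` and the harmonic function
`(a * x + b * y) * (‖z‖⁻² - 1)`, which vanishes on the unit circle. -/
theorem integral_green_annulus {M : ℕ} {lam : ℝ}
    (hV : ContDiffOn ℝ 1 V (closedBall (0 : ℂ) 1))
    (hv1 : ContDiffOn ℝ 1 v (closedBall (0 : ℂ) 1))
    (hv2 : ContDiffOn ℝ 2 v (ball (0 : ℂ) 1))
    (hPDE : ∀ x ∈ ball (0 : ℂ) 1,
      -lap v x = lam * ‖x‖ ^ (2 * (M + 1)) * V x * Real.exp (v x))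
    (hbd : ∀ x ∈ sphere (0 : ℂ) 1, v x = 0) (a b : ℝ) {ε : ℝ} (hε : 0 < ε) (hε1 : ε ≤ 1) :
    ∫ r in ε..1, ∫ θ in (0 : ℝ)..(2 * Real.pi), r *
        (fun z : ℂ => lam * ((a * z.re + b * z.im) * (‖z‖ ^ (2 * M) - ‖z‖ ^ (2 * (M + 1))) * V z *
          Real.exp (v z))) (r * Complex.exp (θ * Complex.I)) =
      ∫ θ in (0 : ℝ)..(2 * Real.pi), (a * Real.cos θ + b * Real.sin θ) *
        ((1 - ε ^ 2) * fderivWithin ℝ v (closedBall 0 1) (ε * Complex.exp (θ * Complex.I))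
          (Complex.exp (θ * Complex.I)) +
          v (ε * Complex.exp (θ * Complex.I)) * (ε + ε⁻¹)) := by
  set K := closedBall (0 : ℂ) 1 with hK
  set g := fderivWithin ℝ v K with hg
  have hsub : K \ ball 0 ε ⊆ K := sdiff_subset
  have hgc : ContinuousOn g K := continuousOn_fderivWithin_closedBall hv1
  have hgc1 : ∀ e, ContinuousOn (fun z => g z e) (K \ ball 0 ε) := fun e =>
    (hgc.clm_apply continuousOn_const).mono hsub
  have hgx := hgc1 1
  have hgy := hgc1 Complex.I
  have hvc := hv1.continuousOn.mono hsub
  have hVc := hV.continuousOn.mono hsub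
  have hinv : ContinuousOn (fun z : ℂ => (‖z‖ ^ 2)⁻¹) (K \ ball 0 ε) := by
    refine ContinuousOn.inv₀ (by fun_prop) fun z hz => ?_
    have : 0 < ‖z‖ := hε.trans_le (by simpa using hz.2)
    positivity
  have key := integral_divergence_annulus hε.le hε1
    (P := fun z => (a * z.re + b * z.im) * ((‖z‖ ^ 2)⁻¹ - 1) * g z 1 -
      v z * (a * ((‖z‖ ^ 2)⁻¹ - 1) - 2 * (z.re * (a * z.re + b * z.im) * ((‖z‖ ^ 2)⁻¹) ^ 2)))
    (Q := fun z => (a * z.re + b * z.im) * ((‖z‖ ^ 2)⁻¹ - 1) * g z Complex.I -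
      v z * (b * ((‖z‖ ^ 2)⁻¹ - 1) - 2 * (z.im * (a * z.re + b * z.im) * ((‖z‖ ^ 2)⁻¹) ^ 2)))
    (D := fun z => -(lam * ((a * z.re + b * z.im) * (‖z‖ ^ (2 * M) - ‖z‖ ^ (2 * (M + 1))) * V z *
          Real.exp (v z))))
    (by fun_prop) (by fun_prop) (by fun_prop) ?_
  · simp only [mul_neg, intervalIntegral.integral_neg] at key ⊢
    rw [neg_eq_iff_eq_neg] at key
    rw [key]
    have hn : ∀ θ : ℝ, ‖Complex.exp (θ * Complex.I)‖ = 1 := Complex.norm_exp_ofReal_mul_I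
    have hv0 : ∀ θ : ℝ, v (Complex.exp (θ * Complex.I)) = 0 := fun θ => hbd _ (by simp [hn])
    simp only [hn, hv0, one_pow, inv_one, sub_self, mul_zero, zero_mul, add_zero,
      intervalIntegral.integral_zero, zero_sub, neg_neg]
    refine intervalIntegral.integral_congr fun θ _ => ?_
    have hnε : ‖(ε : ℂ) * Complex.exp (θ * Complex.I)‖ = ε := by
      rw [norm_mul, hn, mul_one, Complex.norm_real, Real.norm_of_nonneg hε.le]
    simp only [hnε, Complex.re_ofReal_mul, Complex.im_ofReal_mul,
      Complex.exp_ofReal_mul_I_re, Complex.exp_ofReal_mul_I_im]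
    rw [clm_apply_eq (g _) (Complex.exp (θ * Complex.I)),
      Complex.exp_ofReal_mul_I_re, Complex.exp_ofReal_mul_I_im, ← inv_pow]
    have hcs := Real.sin_sq_add_cos_sq θ
    have hεt : ε * ε⁻¹ = 1 := mul_inv_cancel₀ hε.ne'
    generalize Real.cos θ = c at *
    generalize Real.sin θ = s at *
    generalize ε⁻¹ = t at *
    generalize (ε : ℂ) * Complex.exp (θ * Complex.I) = w at *
    linear_combination 2 * v w * ε ^ 3 * (a * c + b * s) * t ^ 4 * hcs +
      ((a * c + b * s) * (c * g w 1 + s * g w Complex.I) * (ε * t + 1) +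
      v w * (a * c + b * s) * t * (2 * (ε * t) ^ 2 + 2 * (ε * t) + 1)) * hεt
  · intro z hz0 hz1
    have hzb : z ∈ ball (0 : ℂ) 1 := by simpa using hz1
    obtain ⟨X, Y, hX, hY, hXY, hlap⟩ := exists_hasFDerivAt_partial hv1 hv2 hzb
    have hdv : HasFDerivAt v (g z) z := hasFDerivAt_of_contDiffOn_closedBall hv1 hzb
    have hre : HasFDerivAt (fun w : ℂ => w.re) Complex.reCLM z := Complex.reCLM.hasFDerivAt
    have him : HasFDerivAt (fun w : ℂ => w.im) Complex.imCLM z := Complex.imCLM.hasFDerivAt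
    have hρ : ‖z‖ ^ 2 ≠ 0 := by have := hε.trans hz0; positivity
    have hs := (hasDerivAt_inv hρ).comp_hasFDerivAt z (hasFDerivAt_norm_sq z)
    replace hs : HasFDerivAt (fun w : ℂ => (‖w‖ ^ 2)⁻¹) _ z := hs
    have hL := (hre.const_mul a).fun_add (him.const_mul b)
    have hs1 := hs.sub_const 1
    refine ⟨_, _, ((hL.fun_mul hs1).fun_mul hX).fun_sub (hdv.fun_mul ((hs1.const_mul a).fun_sub
        (((hre.fun_mul hL).fun_mul (hs.pow 2)).const_mul 2))),
      ((hL.fun_mul hs1).fun_mul hY).fun_sub (hdv.fun_mul ((hs1.const_mul b).fun_sub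
        (((him.fun_mul hL).fun_mul (hs.pow 2)).const_mul 2))), ?_⟩
    have hpde := hPDE z hzb
    rw [← hlap, pow_mul, pow_succ] at hpde
    rw [← hK, ← hg]
    have hinv2 : -((‖z‖ ^ 2) ^ 2)⁻¹ = -((‖z‖ ^ 2)⁻¹) ^ 2 := by rw [inv_pow]
    have hsρ : (‖z‖ ^ 2)⁻¹ * ‖z‖ ^ 2 = 1 := inv_mul_cancel₀ hρ
    rw [hinv2]
    rw [norm_sq_eq] at hsρ
    generalize hsdef : (‖z‖ ^ 2)⁻¹ = s at *
    simp only [_root_.add_apply, _root_.sub_apply, _root_.smul_apply, smul_eq_mul,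
      Complex.reCLM_apply, Complex.imCLM_apply, Complex.one_re, Complex.one_im, Complex.I_re,
      Complex.I_im, pow_mul, pow_succ, nsmul_eq_mul, pow_zero, one_mul, Nat.cast_ofNat]
    rw [← pow_two ‖z‖, norm_sq_eq] at *
    generalize (z.re ^ 2 + z.im ^ 2) ^ M = m at *
    rw [hsdef] at hsρ
    linear_combination -((a * z.re + b * z.im) * (s - 1)) * hpde -
      (lam * (a * z.re + b * z.im) * m * V z * Real.exp (v z) +
        8 * v z * (a * z.re + b * z.im) * s ^ 2) * hsρ

theorem integral_cos_sin_mul (a b p q : ℝ) :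
    ∫ θ in (0 : ℝ)..(2 * Real.pi), (a * Real.cos θ + b * Real.sin θ) *
      (2 * (Real.cos θ * p + Real.sin θ * q)) = 2 * Real.pi * (a * p + b * q) := by
  have h : ∀ θ : ℝ, (a * Real.cos θ + b * Real.sin θ) * (2 * (Real.cos θ * p + Real.sin θ * q)) =
      (2 * a * p) * Real.cos θ ^ 2 + (2 * b * q) * Real.sin θ ^ 2 +
        (2 * (a * q + b * p)) * (Real.sin θ * Real.cos θ) := fun θ => by ring
  simp only [h]
  rw [intervalIntegral.integral_add, intervalIntegral.integral_add,
    intervalIntegral.integral_const_mul, intervalIntegral.integral_const_mul,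
    intervalIntegral.integral_const_mul, integral_cos_sq, integral_sin_sq, integral_sin_mul_cos₁]
  · simp
    ring
  all_goals exact Continuous.intervalIntegrable (by fun_prop) _ _

theorem tendsto_integral_green_circle (hv1 : ContDiffOn ℝ 1 v (closedBall (0 : ℂ) 1)) (a b : ℝ) :
    Tendsto (fun ε : ℝ => ∫ θ in (0 : ℝ)..(2 * Real.pi), (a * Real.cos θ + b * Real.sin θ) *
        ((1 - ε ^ 2) * fderivWithin ℝ v (closedBall 0 1) (ε * Complex.exp (θ * Complex.I))
          (Complex.exp (θ * Complex.I)) +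
          v (ε * Complex.exp (θ * Complex.I)) * (ε + ε⁻¹))) (𝓝[>] 0)
      (𝓝 (2 * Real.pi * (a * fderivWithin ℝ v (closedBall 0 1) 0 1 +
        b * fderivWithin ℝ v (closedBall 0 1) 0 Complex.I))) := by
  set K := closedBall (0 : ℂ) 1 with hK
  set g := fderivWithin ℝ v K with hg
  have hgc : ContinuousOn g K := continuousOn_fderivWithin_closedBall hv1
  have h0 : (0 : ℂ) ∈ K := by simp [hK]
  have hmem : ∀ ε ∈ Ioo (0 : ℝ) 1, ∀ θ : ℝ, (ε : ℂ) * Complex.exp (θ * Complex.I) ∈ K :=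
    fun ε hε θ => (polar_mem hε.1.le θ ⟨le_rfl, hε.2.le⟩).1
  have hne : ∀ θ : ℝ, ‖Complex.exp (θ * Complex.I)‖ = 1 := Complex.norm_exp_ofReal_mul_I
  have hcont : ∀ ε ∈ Ioo (0 : ℝ) 1,
      Continuous (fun θ : ℝ =>
        g (ε * Complex.exp (θ * Complex.I)) (Complex.exp (θ * Complex.I))) ∧
      Continuous (fun θ : ℝ => v (ε * Complex.exp (θ * Complex.I))) := fun ε hε =>
    ⟨(hgc.comp_continuous (by fun_prop) (hmem ε hε)).clm_apply (by fun_prop),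
      hv1.continuousOn.comp_continuous (by fun_prop) (hmem ε hε)⟩
  obtain ⟨C, hC⟩ := (isCompact_closedBall (0 : ℂ) 1).exists_bound_of_continuousOn hgc
  have hC0 : 0 ≤ C := (norm_nonneg _).trans (hC 0 h0)
  have hlip : ∀ ε ∈ Ioo (0 : ℝ) 1, ∀ θ : ℝ,
      ‖v (ε * Complex.exp (θ * Complex.I)) - v 0‖ ≤ C * ε := by
    intro ε hε θ
    have := (convex_closedBall (0 : ℂ) 1).norm_image_sub_le_of_norm_hasFDerivWithin_le
      (fun x hx => (hv1.differentiableOn one_ne_zero x hx).hasFDerivWithinAt) hC h0 (hmem ε hε θ)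
    simpa [hne, abs_of_pos hε.1] using this
  rw [← integral_cos_sin_mul]
  have htrig : Continuous fun θ : ℝ => a * Real.cos θ + b * Real.sin θ := by fun_prop
  have hIoo : Ioo (0 : ℝ) 1 ∈ 𝓝[>] (0 : ℝ) := Ioo_mem_nhdsGT zero_lt_one
  have hcs0 : ∫ θ in (0 : ℝ)..(2 * Real.pi), (a * Real.cos θ + b * Real.sin θ) = 0 := by
    rw [intervalIntegral.integral_add (Continuous.intervalIntegrable (by fun_prop) _ _)
      (Continuous.intervalIntegrable (by fun_prop) _ _)]
    simp
  have hcongr : ∀ ε ∈ Ioo (0 : ℝ) 1,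
      ∫ θ in (0 : ℝ)..(2 * Real.pi), (a * Real.cos θ + b * Real.sin θ) *
        ((1 - ε ^ 2) * g (ε * Complex.exp (θ * Complex.I)) (Complex.exp (θ * Complex.I)) +
          (v (ε * Complex.exp (θ * Complex.I)) - v 0) * (ε + ε⁻¹)) =
      ∫ θ in (0 : ℝ)..(2 * Real.pi), (a * Real.cos θ + b * Real.sin θ) *
        ((1 - ε ^ 2) * g (ε * Complex.exp (θ * Complex.I)) (Complex.exp (θ * Complex.I)) +
          v (ε * Complex.exp (θ * Complex.I)) * (ε + ε⁻¹)) := by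
    intro ε hε
    obtain ⟨hg', hv'⟩ := hcont ε hε
    rw [← sub_eq_zero, ← intervalIntegral.integral_sub]
    · trans ∫ θ in (0 : ℝ)..(2 * Real.pi),
        (-v 0 * (ε + ε⁻¹)) * (a * Real.cos θ + b * Real.sin θ)
      · refine intervalIntegral.integral_congr fun θ _ => ?_
        ring
      · rw [intervalIntegral.integral_const_mul, hcs0, mul_zero]
    · exact (htrig.mul ((continuous_const.mul hg').add
        ((hv'.sub continuous_const).mul continuous_const))).intervalIntegrable _ _
    · exact (htrig.mul ((continuous_const.mul hg').add
        (hv'.mul continuous_const))).intervalIntegrable _ _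
  refine Tendsto.congr' (by filter_upwards [hIoo] with ε hε using hcongr ε hε) ?_
  refine intervalIntegral.tendsto_integral_filter_of_dominated_convergence
    (fun _ => (|a| + |b|) * (3 * C)) ?_ ?_ (by simp) ?_
  · filter_upwards [hIoo] with ε hε
    obtain ⟨hg', hv'⟩ := hcont ε hε
    exact (htrig.mul ((continuous_const.mul hg').add
      ((hv'.sub continuous_const).mul continuous_const))).aestronglyMeasurable
  · filter_upwards [hIoo] with ε hε
    refine Eventually.of_forall fun θ _ => ?_
    rw [norm_mul]
    have hε0 := hε.1
    have hε1 := hε.2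
    have h1 : ‖a * Real.cos θ + b * Real.sin θ‖ ≤ |a| + |b| := by
      refine (norm_add_le _ _).trans ?_
      rw [norm_mul, norm_mul]
      exact add_le_add (mul_le_of_le_one_right (abs_nonneg _) (Real.abs_cos_le_one _))
        (mul_le_of_le_one_right (abs_nonneg _) (Real.abs_sin_le_one _))
    have h2 : ‖g (ε * Complex.exp (θ * Complex.I)) (Complex.exp (θ * Complex.I))‖ ≤ C := by
      have := (g (ε * Complex.exp (θ * Complex.I))).le_opNorm (Complex.exp (θ * Complex.I))
      rw [hne, mul_one] at this
      exact this.trans (hC _ (hmem ε hε θ))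
    have h3 := hlip ε hε θ
    have h4 : ‖(1 - ε ^ 2) * g (ε * Complex.exp (θ * Complex.I)) (Complex.exp (θ * Complex.I))‖
        ≤ 1 * C := by
      rw [norm_mul]
      refine mul_le_mul ?_ h2 (norm_nonneg _) zero_le_one
      rw [Real.norm_of_nonneg (by nlinarith)]
      nlinarith
    have h5 : ‖(v (ε * Complex.exp (θ * Complex.I)) - v 0) * (ε + ε⁻¹)‖ ≤ C * 2 := by
      rw [norm_mul, Real.norm_of_nonneg (by positivity : 0 ≤ ε + ε⁻¹)]
      calc _ ≤ C * ε * (ε + ε⁻¹) := by gcongr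
        _ = C * (ε ^ 2 + 1) := by field_simp
        _ ≤ C * 2 := by gcongr; nlinarith
    have h6 := norm_add_le ((1 - ε ^ 2) *
      g (ε * Complex.exp (θ * Complex.I)) (Complex.exp (θ * Complex.I)))
      ((v (ε * Complex.exp (θ * Complex.I)) - v 0) * (ε + ε⁻¹))
    exact mul_le_mul h1 (by linarith) (norm_nonneg _) (by positivity)
  · refine Eventually.of_forall fun θ _ => ?_
    refine Tendsto.const_mul _ ?_
    rw [← Complex.exp_ofReal_mul_I_re, ← Complex.exp_ofReal_mul_I_im, ← clm_apply_eq, two_mul]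
    set e := Complex.exp (θ * Complex.I) with he
    have hid : Tendsto (fun ε : ℝ => ε) (𝓝[>] 0) (𝓝 0) := nhdsWithin_le_nhds
    have hK0 : K ∈ 𝓝 (0 : ℂ) := closedBall_mem_nhds _ zero_lt_one
    have hline : HasDerivAt (fun ε : ℝ => (ε : ℂ) * e) e 0 := by
      simpa using (Complex.ofRealCLM.hasDerivAt (x := 0)).mul_const e
    have hline0 : Tendsto (fun ε : ℝ => (ε : ℂ) * e) (𝓝[>] 0) (𝓝 0) := by
      have := hline.continuousAt.tendsto
      simp only [Complex.ofReal_zero, zero_mul] at this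
      exact this.mono_left nhdsWithin_le_nhds
    have hgt : Tendsto (fun ε : ℝ => g (ε * e) e) (𝓝[>] 0) (𝓝 (g 0 e)) :=
      ((hgc.clm_apply continuousOn_const).continuousAt hK0 (f := fun z => g z e)).tendsto.comp hline0
    have hv0 : HasFDerivAt v (g 0) ((0 : ℝ) * e) := by
      simpa using hasFDerivAt_of_contDiffOn_closedBall hv1 (by simp : (0 : ℂ) ∈ ball (0 : ℂ) 1)
    have hslope := (hv0.comp_hasDerivAt (0 : ℝ) hline).tendsto_slope_zero_right
    simp only [zero_add, Function.comp_apply, Complex.ofReal_zero, zero_mul, smul_eq_mul] at hslope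
    refine Tendsto.add ?_ ?_
    · simpa using ((tendsto_const_nhds (x := (1 : ℝ))).sub (hid.pow 2)).mul hgt
    · have := (((hid.pow 2).const_add 1).mul hslope)
      simp only [ne_eq, OfNat.ofNat_ne_zero, not_false_eq_true, zero_pow, add_zero, one_mul] at this
      refine this.congr' ?_
      filter_upwards [hIoo] with ε hε
      have := hε.1.ne'
      field_simp
      ring

/-- Representation of the directional derivative of `v` at the origin, obtained by letting the inner
radius in `integral_green_annulus` tend to zero. -/
theorem integral_green_ball {M : ℕ} {lam : ℝ}
    (hV : ContDiffOn ℝ 1 V (closedBall (0 : ℂ) 1))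
    (hv1 : ContDiffOn ℝ 1 v (closedBall (0 : ℂ) 1))
    (hv2 : ContDiffOn ℝ 2 v (ball (0 : ℂ) 1))
    (hPDE : ∀ x ∈ ball (0 : ℂ) 1,
      -lap v x = lam * ‖x‖ ^ (2 * (M + 1)) * V x * Real.exp (v x))
    (hbd : ∀ x ∈ sphere (0 : ℂ) 1, v x = 0) (a b : ℝ) :
    ∫ z in ball (0 : ℂ) 1, lam * ((a * z.re + b * z.im) *
        (‖z‖ ^ (2 * M) - ‖z‖ ^ (2 * (M + 1))) * V z * Real.exp (v z)) =
      2 * Real.pi * (a * fderiv ℝ v 0 1 + b * fderiv ℝ v 0 Complex.I) := by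
  have hVc := hV.continuousOn
  have hvc := hv1.continuousOn
  rw [(hasFDerivAt_of_contDiffOn_closedBall hv1 (by simp : (0 : ℂ) ∈ ball (0 : ℂ) 1)).fderiv]
  refine tendsto_nhds_unique (tendsto_integral_annulus (by fun_prop)) ?_
  refine (tendsto_integral_green_circle hv1 a b).congr' ?_
  filter_upwards [Ioo_mem_nhdsGT zero_lt_one] with ε hε
  exact (integral_green_annulus hV hv1 hv2 hPDE hbd a b hε.1 hε.2.le).symm

/-- The Pohozaev identity in an arbitrary direction `(a, b)`. -/
theorem pohozaev_identity_direction {M : ℕ} {lam : ℝ}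
    (hV : ContDiffOn ℝ 1 V (closedBall (0 : ℂ) 1))
    (hv1 : ContDiffOn ℝ 1 v (closedBall (0 : ℂ) 1))
    (hv2 : ContDiffOn ℝ 2 v (ball (0 : ℂ) 1))
    (hPDE : ∀ x ∈ ball (0 : ℂ) 1,
      -lap v x = lam * ‖x‖ ^ (2 * (M + 1)) * V x * Real.exp (v x))
    (hbd : ∀ x ∈ sphere (0 : ℂ) 1, v x = 0) (a b : ℝ) :
    (1 / 2) * (∫ θ in (0:ℝ)..(2 * Real.pi),
        (fderivWithin ℝ v (closedBall (0 : ℂ) 1) (Complex.exp (θ * Complex.I))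
          (Complex.exp (θ * Complex.I))) ^ 2 * (a * Real.cos θ + b * Real.sin θ))
      - 2 * (M + 1) * lam * (∫ y in ball (0 : ℂ) 1,
        (a * y.re + b * y.im) * ‖y‖ ^ (2 * (M + 1)) * V y * Real.exp (v y))
      + lam * (∫ θ in (0:ℝ)..(2 * Real.pi),
        (a * Real.cos θ + b * Real.sin θ) * V (Complex.exp (θ * Complex.I)))
      = 4 * (M + 1) * Real.pi * (a * fderiv ℝ v 0 1 + b * fderiv ℝ v 0 Complex.I)
        + lam * ∫ x in ball (0 : ℂ) 1, ‖x‖ ^ (2 * (M + 1)) *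
          (a * fderiv ℝ V x 1 + b * fderiv ℝ V x Complex.I) * Real.exp (v x) := by
  have hA := integral_translation_divergence hV hv1 hv2 hPDE hbd a b
  have hB := integral_green_ball hV hv1 hv2 hPDE hbd a b
  have hVc := hV.continuousOn
  have hvc := hv1.continuousOn
  have hG : ∀ e, ContinuousOn (fun z => fderivWithin ℝ V (closedBall 0 1) z e)
      (closedBall 0 1) := fun e =>
    (continuousOn_fderivWithin_closedBall hV).clm_apply continuousOn_const
  have hGx := hG 1
  have hGy := hG Complex.I
  have hmem : ∀ θ : ℝ, Complex.exp (θ * Complex.I) ∈ closedBall (0 : ℂ) 1 := fun θ => by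
    simp [Complex.norm_exp_ofReal_mul_I]
  have hg : Continuous (fun θ : ℝ => fderivWithin ℝ v (closedBall (0 : ℂ) 1)
      (Complex.exp (θ * Complex.I))) :=
    (continuousOn_fderivWithin_closedBall hv1).comp_continuous (by fun_prop) hmem
  have hVθ : Continuous (fun θ : ℝ => V (Complex.exp (θ * Complex.I))) :=
    hVc.comp_continuous (by fun_prop) hmem
  have hint : ∀ {D : ℂ → ℝ}, ContinuousOn D (closedBall 0 1) →
      Integrable D (volume.restrict (ball (0 : ℂ) 1)) := fun hD =>
    (hD.integrableOn_compact (isCompact_closedBall 0 1)).mono_set ball_subset_closedBall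
  rw [intervalIntegral.integral_add (Continuous.intervalIntegrable (by fun_prop) _ _)
    (Continuous.intervalIntegrable (by
      exact continuous_const.mul ((by fun_prop : Continuous fun θ : ℝ =>
        a * Real.cos θ + b * Real.sin θ).mul hVθ)) _ _),
    intervalIntegral.integral_const_mul,
    intervalIntegral.integral_const_mul] at hA
  have hA' : ∀ z : ℂ, lam * (2 * (M + 1) * (a * z.re + b * z.im) * ‖z‖ ^ (2 * M) * V z +
      ‖z‖ ^ (2 * (M + 1)) * (a * fderivWithin ℝ V (closedBall 0 1) z 1 +
        b * fderivWithin ℝ V (closedBall 0 1) z Complex.I)) * Real.exp (v z) =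
      (2 * (M + 1) * lam) * ((a * z.re + b * z.im) * ‖z‖ ^ (2 * M) * V z * Real.exp (v z)) +
      lam * (‖z‖ ^ (2 * (M + 1)) * (a * fderivWithin ℝ V (closedBall 0 1) z 1 +
        b * fderivWithin ℝ V (closedBall 0 1) z Complex.I) * Real.exp (v z)) := fun z => by ring
  have hB' : ∀ z : ℂ, lam * ((a * z.re + b * z.im) * (‖z‖ ^ (2 * M) - ‖z‖ ^ (2 * (M + 1))) *
      V z * Real.exp (v z)) =
      lam * ((a * z.re + b * z.im) * ‖z‖ ^ (2 * M) * V z * Real.exp (v z)) -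
      lam * ((a * z.re + b * z.im) * ‖z‖ ^ (2 * (M + 1)) * V z * Real.exp (v z)) :=
    fun z => by ring
  simp only [hA'] at hA
  simp only [hB'] at hB
  rw [integral_add (hint (by fun_prop)) (hint (by fun_prop)), integral_const_mul,
    integral_const_mul] at hA
  rw [integral_sub (hint (by fun_prop)) (hint (by fun_prop)), integral_const_mul,
    integral_const_mul] at hB
  have hV' : ∫ x in ball (0 : ℂ) 1, ‖x‖ ^ (2 * (M + 1)) *
        (a * fderiv ℝ V x 1 + b * fderiv ℝ V x Complex.I) * Real.exp (v x) =
      ∫ x in ball (0 : ℂ) 1, ‖x‖ ^ (2 * (M + 1)) *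
        (a * fderivWithin ℝ V (closedBall 0 1) x 1 +
          b * fderivWithin ℝ V (closedBall 0 1) x Complex.I) * Real.exp (v x) :=
    setIntegral_congr_fun measurableSet_ball fun x hx => by
      simp only [(hasFDerivAt_of_contDiffOn_closedBall hV hx).fderiv]
  rw [hV']
  linear_combination 2 * (M + 1) * hB - hA

end Pohozaev

/-- **Proposition 7.1** specialized to the unit ball: the first Pohozaev identity, for
`i = 1, 2`. -/
theorem pohozaev_identity_ball
    (N : ℕ) (hN : 1 ≤ N) (lam : ℝ) (hlam : 0 < lam)
    (V v : ℂ → ℝ)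
    (hV : ContDiffOn ℝ 1 V (closedBall (0 : ℂ) 1))
    (hVpos : ∀ x ∈ closedBall (0 : ℂ) 1, 0 < V x)
    (hv1 : ContDiffOn ℝ 1 v (closedBall (0 : ℂ) 1))
    (hv2 : ContDiffOn ℝ 2 v (ball (0 : ℂ) 1))
    (hPDE : ∀ x ∈ ball (0 : ℂ) 1, -lap v x = lam * ‖x‖ ^ (2 * N) * V x * Real.exp (v x))
    (hbd : ∀ x ∈ sphere (0 : ℂ) 1, v x = 0) :
    ((1 / 2) * (∫ θ in (0:ℝ)..(2 * Real.pi),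
        (fderivWithin ℝ v (closedBall (0 : ℂ) 1) (Complex.exp (θ * Complex.I))
          (Complex.exp (θ * Complex.I))) ^ 2 * Real.cos θ)
      - 2 * N * lam * (∫ y in ball (0 : ℂ) 1, y.re * ‖y‖ ^ (2 * N) * V y * Real.exp (v y))
      + lam * (∫ θ in (0:ℝ)..(2 * Real.pi), Real.cos θ * V (Complex.exp (θ * Complex.I)))
      = 4 * N * Real.pi * pd 1 0 v 0
        + lam * ∫ x in ball (0 : ℂ) 1, ‖x‖ ^ (2 * N) * pd 1 0 V x * Real.exp (v x)) ∧
    ((1 / 2) * (∫ θ in (0:ℝ)..(2 * Real.pi),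
        (fderivWithin ℝ v (closedBall (0 : ℂ) 1) (Complex.exp (θ * Complex.I))
          (Complex.exp (θ * Complex.I))) ^ 2 * Real.sin θ)
      - 2 * N * lam * (∫ y in ball (0 : ℂ) 1, y.im * ‖y‖ ^ (2 * N) * V y * Real.exp (v y))
      + lam * (∫ θ in (0:ℝ)..(2 * Real.pi), Real.sin θ * V (Complex.exp (θ * Complex.I)))
      = 4 * N * Real.pi * pd 0 1 v 0
        + lam * ∫ x in ball (0 : ℂ) 1, ‖x‖ ^ (2 * N) * pd 0 1 V x * Real.exp (v x)) := by
  obtain ⟨M, rfl⟩ : ∃ M, N = M + 1 := ⟨N - 1, by omega⟩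
  have h1 := pohozaev_identity_direction hV hv1 hv2 hPDE hbd 1 0
  have h2 := pohozaev_identity_direction hV hv1 hv2 hPDE hbd 0 1
  simp only [one_mul, zero_mul, add_zero, zero_add] at h1 h2
  push_cast
  exact ⟨h1, h2⟩
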